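/- Let p be a monotonic fixed-size binary tree source. Define p' on finite tuples of positive integers by p'(n_1,…,n_k) = ∏_{j=1}^{k} p(n_j − 1, n_{j+1} + ⋯ + n_k) (empty product = 1). Then p' is a monotonic fixed-size ordinal tree source: (a) for every m ∈ ℕ₀ the sum of p' over all compositions of m into positive parts equals 1, and (b) p' satisfies the three monotonicity conditions (i)–(iii) for ordinal sources. -/

import Mathlib

/-- The fixed-size ordinal tree source derived from a fixed-size binary tree
source `p` via the first-child next-sibling correspondence:
`p'(n_1,…,n_k) = ∏_{j=1}^{k} p (n_j − 1) (n_{j+1} + ⋯ + n_k)`. -/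
noncomputable def fcnsSource (p : ℕ → ℕ → ℝ) : List ℕ → ℝ
  | [] => 1
  | n :: ns => p (n - 1) ns.sum * fcnsSource p ns

theorem fcns_nonneg (p : ℕ → ℕ → ℝ) (hp : ∀ ℓ r : ℕ, 0 ≤ p ℓ r ∧ p ℓ r ≤ 1) (l : List ℕ) :
    0 ≤ fcnsSource p l := by
  induction l with
  | nil => simp [fcnsSource]
  | cons a l ih => exact mul_nonneg (hp _ _).1 ih

theorem fcns_append_mono (p : ℕ → ℕ → ℝ) (hp : ∀ ℓ r : ℕ, 0 ≤ p ℓ r ∧ p ℓ r ≤ 1)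
    (hmono2 : ∀ ℓ r : ℕ, p ℓ (r + 1) ≤ p ℓ r) (l₁ l l' : List ℕ)
    (hs : l'.sum ≤ l.sum) (h : fcnsSource p l ≤ fcnsSource p l') :
    fcnsSource p (l₁ ++ l) ≤ fcnsSource p (l₁ ++ l') := by
  induction l₁ with
  | nil => exact h
  | cons a t ih =>
    have h2 : p (a - 1) (t ++ l).sum ≤ p (a - 1) (t ++ l').sum :=
      antitone_nat_of_succ_le (hmono2 (a - 1)) (by simpa using hs)
    exact mul_le_mul h2 ih (fcns_nonneg p hp _) (hp _ _).1

def consComp (m : ℕ) (x : Σ ℓ : Fin (m + 1), Composition (m - ℓ)) : Composition (m + 1) where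
  blocks := (x.1.1 + 1) :: x.2.blocks
  blocks_pos := by
    intro i hi
    rcases List.mem_cons.1 hi with h | h
    · omega
    · exact x.2.blocks_pos h
  blocks_sum := by
    have := x.2.blocks_sum
    have := x.1.2
    simp only [List.sum_cons]
    omega

theorem consComp_bij (m : ℕ) : Function.Bijective (consComp m) := by
  constructor
  · rintro ⟨a, c⟩ ⟨b, d⟩ h
    have h' := congrArg Composition.blocks h
    simp only [consComp, List.cons.injEq, Nat.add_right_cancel_iff] at h'
    obtain ⟨h1, h2⟩ := h'
    obtain rfl : a = b := Fin.ext h1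
    obtain rfl : c = d := Composition.ext h2
    rfl
  · rintro ⟨l, hpos, hsum⟩
    cases l with
    | nil => simp at hsum
    | cons a t =>
      have ha : 0 < a := hpos (by simp)
      simp only [List.sum_cons] at hsum
      refine ⟨⟨⟨a - 1, by omega⟩, ⟨t, fun h => hpos (by simp [h]), ?_⟩⟩, ?_⟩
      · show t.sum = m - (a - 1)
        omega
      · apply Composition.ext
        show (a - 1 + 1) :: t = a :: t
        rw [Nat.sub_add_cancel ha]

theorem fcns_sum (p : ℕ → ℕ → ℝ)
    (hpsum : ∀ n : ℕ, ∑ ℓ ∈ Finset.range (n + 1), p ℓ (n - ℓ) = 1) (m : ℕ) :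
    ∑ c : Composition m, fcnsSource p c.blocks = 1 := by
  induction m using Nat.strong_induction_on with
  | _ m ih =>
    cases m with
    | zero =>
      have : ∀ c : Composition 0, fcnsSource p c.blocks = 1 := by
        intro c
        have : c.blocks = [] := by
          cases h : c.blocks with
          | nil => rfl
          | cons a t =>
            have h1 := c.blocks_sum
            have h2 : 0 < a := c.blocks_pos (by simp [h])
            simp [h] at h1
            omega
        rw [this]; rfl
      simp [this, composition_card]
    | succ m =>
      rw [← (consComp_bij m).sum_comp, Fintype.sum_sigma, ← hpsum m, ← Fin.sum_univ_eq_sum_range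
        (fun ℓ => p ℓ (m - ℓ))]
      refine Finset.sum_congr rfl fun a _ => ?_
      have : ∀ c : Composition (m - a), fcnsSource p (consComp m ⟨a, c⟩).blocks
          = p a (m - a) * fcnsSource p c.blocks := by
        intro c
        simp [consComp, fcnsSource, c.blocks_sum]
      simp only [this]
      rw [← Finset.mul_sum, ih _ (by omega), mul_one]

/-- if `p` is a monotonic fixed-size binary tree source, then
`fcnsSource p` is a monotonic fixed-size ordinal tree source:
(a) it sums to 1 over the compositions of every `m ∈ ℕ`, and
(b) it satisfies the three monotonicity conditions (i)–(iii) for ordinal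
sources (on tuples of positive integers). -/
theorem statement14 (p : ℕ → ℕ → ℝ)
    (hp01 : ∀ ℓ r : ℕ, 0 ≤ p ℓ r ∧ p ℓ r ≤ 1)
    (hpsum : ∀ n : ℕ, ∑ ℓ ∈ Finset.range (n + 1), p ℓ (n - ℓ) = 1)
    (hmono1 : ∀ ℓ r : ℕ, p (ℓ + 1) r ≤ p ℓ r)
    (hmono2 : ∀ ℓ r : ℕ, p ℓ (r + 1) ≤ p ℓ r) :
    -- (a) `fcnsSource p` is a fixed-size ordinal tree source:
    (∀ m : ℕ, ∑ c : Composition m, fcnsSource p c.blocks = 1) ∧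
    -- (b)(i) weakly decreasing in every component:
    (∀ l₁ l₂ : List ℕ, ∀ a : ℕ, (∀ x ∈ l₁, 1 ≤ x) → (∀ x ∈ l₂, 1 ≤ x) → 1 ≤ a →
      fcnsSource p (l₁ ++ (a + 1) :: l₂) ≤ fcnsSource p (l₁ ++ a :: l₂)) ∧
    -- (b)(ii) weakly decreasing upon adding new subtrees:
    (∀ l₁ l₂ : List ℕ, (∀ x ∈ l₁, 1 ≤ x) → (∀ x ∈ l₂, 1 ≤ x) →
      fcnsSource p (l₁ ++ 1 :: l₂) ≤ fcnsSource p (l₁ ++ l₂)) ∧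
    -- (b)(iii) sub-multiplicative:
    (∀ l₁ l₂ : List ℕ, (∀ x ∈ l₁, 1 ≤ x) → (∀ x ∈ l₂, 1 ≤ x) →
      fcnsSource p (l₁ ++ l₂) ≤ fcnsSource p l₁ * fcnsSource p l₂) := by
  refine ⟨fcns_sum p hpsum, ?_, ?_, ?_⟩
  · intro l₁ l₂ a _ _ ha
    apply fcns_append_mono p hp01 hmono2
    · simp
    · obtain ⟨b, rfl⟩ : ∃ b, a = b + 1 := ⟨a - 1, by omega⟩
      exact mul_le_mul_of_nonneg_right (hmono1 _ _) (fcns_nonneg p hp01 _)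
  · intro l₁ l₂ _ _
    apply fcns_append_mono p hp01 hmono2
    · simp
    · exact mul_le_of_le_one_left (fcns_nonneg p hp01 _) (hp01 _ _).2
  · intro l₁ l₂ _ _
    induction l₁ with
    | nil => simp [fcnsSource]
    | cons a t ih =>
      have h2 : p (a - 1) (t ++ l₂).sum ≤ p (a - 1) t.sum :=
        antitone_nat_of_succ_le (hmono2 (a - 1)) (by simp)
      have ih := ih (by simp_all)
      simp only [List.cons_append, fcnsSource]
      rw [mul_assoc]
      exact mul_le_mul h2 ih (fcns_nonneg p hp01 _) (hp01 _ _).1
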